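/- Assume 1 ≤ k, 3k ≤ n, and d_j ≠ 0 for j = 0,…,k−1. Then B_1^{(L)}·B_1^{(l)}·A_{n+1,k,2k}(L,l,d,r,R)·B_1^{(r)}·B_1^{(R)} equals the block-diagonal direct sum E_1 ⊕ A*, where E_1 is the k×k diagonal matrix with diagonal entries d_0,…,d_{k−1}, and A* is the (n+1−k)×(n+1−k) k,2k-pentadiagonal matrix A_{n+1−k,k,2k}(L^{(1)},l^{(1)},d^{(1)},r^{(1)},R^{(1)}) whose diagonal vectors (indexed by j = k,…) are: L^{(1)} = (L_k,…,L_{n−2k}), R^{(1)} = (R_k,…,R_{n−2k}); l^{(1)}_j = l_j − L_{j−k}·r_{j−k}/d_{j−k} for k ≤ j ≤ 2k−1 and l^{(1)}_j = l_j for 2k ≤ j ≤ n−k; r^{(1)}_j = r_j − R_{j−k}·l_{j−k}/d_{j−k} for k ≤ j ≤ 2k−1 and r^{(1)}_j = r_j for 2k ≤ j ≤ n−k; d^{(1)}_j = d_j − l_{j−k}·r_{j−k}/d_{j−k} for k ≤ j ≤ 2k−1, d^{(1)}_j = d_j − L_{j−2k}·R_{j−2k}/d_{j−2k} for 2k ≤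 j ≤ 3k−1, and d^{(1)}_j = d_j for 3k ≤ j ≤ n. -/

import Mathlib

/-- Entry function of a `k,2k`-pentadiagonal matrix. -/
def pentaFun (k : ℕ) (L l d r R : ℕ → ℂ) (i j : ℕ) : ℂ :=
  if j + 2 * k = i then L j
  else if j + k = i then l j
  else if i = j then d i
  else if i + k = j then r i
  else if i + 2 * k = j then R i
  else 0

/-- The `m × m` `k,2k`-pentadiagonal matrix `A_{m,k,2k}(L,l,d,r,R)`. -/
def pentaMat (m k : ℕ) (L l d r R : ℕ → ℂ) : Matrix (Fin m) (Fin m) ℂ :=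
  Matrix.of fun i j => pentaFun k L l d r R i j

/-- Subtract `a (i - s)` times row `i - s` from row `i`, for `s ≤ i < s + k`. -/
noncomputable def rowOp (s k : ℕ) (a : ℕ → ℂ) (F : ℕ → ℕ → ℂ) (i j : ℕ) : ℂ :=
  if s ≤ i ∧ i < s + k then F i j - a (i - s) * F (i - s) j else F i j

/-- Subtract `a (j - s)` times column `j - s` from column `j`, for `s ≤ j < s + k`. -/
noncomputable def colOp (s k : ℕ) (a : ℕ → ℂ) (F : ℕ → ℕ → ℂ) (i j : ℕ) : ℂ :=
  if s ≤ j ∧ j < s + k then F i j - a (j - s) * F i (j - s) else F i j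

lemma left_op (m s k : ℕ) (hs : 1 ≤ s) (a : ℕ → ℂ)
    (F : ℕ → ℕ → ℂ) (B : Matrix (Fin m) (Fin m) ℂ)
    (hB : ∀ i j : Fin m, B i j = if (i : ℕ) = j then (1 : ℂ)
        else if (s ≤ (i : ℕ) ∧ (i : ℕ) < s + k) ∧ (j : ℕ) + s = i then -(a j) else 0) :
    B * (Matrix.of fun i j : Fin m => F i j) =
    Matrix.of fun i j : Fin m => rowOp s k a F i j := by
  ext i j
  simp only [Matrix.mul_apply, Matrix.of_apply, hB, rowOp]
  by_cases h : s ≤ (i : ℕ) ∧ (i : ℕ) < s + k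
  · have hsi := h.1
    have hi := i.2
    have hne : i ≠ (⟨i - s, by omega⟩ : Fin m) := by
      intro h'
      have := congrArg Fin.val h'
      simp at this
      omega
    rw [Fintype.sum_eq_add i ⟨i - s, by omega⟩ hne]
    · have h1 : ¬ ((i : ℕ) = i - s) := by omega
      have h2 : (i : ℕ) - s + s = i := by omega
      simp [h, h1, h2]
      ring
    · rintro x ⟨hx1, hx2⟩
      have h1 : ¬ ((i : ℕ) = x) := fun h' => hx1 (Fin.ext h'.symm)
      have h2 : ¬ ((x : ℕ) + s = i) := fun h' => hx2 (Fin.ext (by simp; omega))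
      simp [h1, h2]
  · rw [Fintype.sum_eq_single i]
    · simp [h]
    · intro x hx1
      have h1 : ¬ ((i : ℕ) = x) := fun h' => hx1 (Fin.ext h'.symm)
      simp [h1, h]

lemma right_op (m s k : ℕ) (hs : 1 ≤ s) (a : ℕ → ℂ)
    (F : ℕ → ℕ → ℂ) (B : Matrix (Fin m) (Fin m) ℂ)
    (hB : ∀ i j : Fin m, B i j = if (i : ℕ) = j then (1 : ℂ)
        else if (i : ℕ) < k ∧ (i : ℕ) + s = j then -(a i) else 0) :
    (Matrix.of fun i j : Fin m => F i j) * B =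
    Matrix.of fun i j : Fin m => colOp s k a F i j := by
  have h := left_op m s k hs a (fun i j => F j i)
    B.transpose (by
      intro i j
      rw [Matrix.transpose_apply, hB]
      by_cases hij : (i : ℕ) = j
      · rw [if_pos hij, if_pos hij.symm]
      · rw [if_neg hij, if_neg (fun h => hij h.symm)]
        refine if_congr ?_ rfl rfl
        omega)
  have h2 := congrArg Matrix.transpose h
  rw [Matrix.transpose_mul, Matrix.transpose_transpose] at h2
  exact h2

lemma region (k i : ℕ) : i < k ∨ (∃ c < k, i = c + k) ∨ (∃ c < k, i = c + 2 * k) ∨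
    ∃ c, i = c + 3 * k := by
  by_cases h1 : i < k
  · exact Or.inl h1
  by_cases h2 : i < 2 * k
  · exact Or.inr (Or.inl ⟨i - k, by omega, by omega⟩)
  by_cases h3 : i < 3 * k
  · exact Or.inr (Or.inr (Or.inl ⟨i - 2 * k, by omega, by omega⟩))
  · exact Or.inr (Or.inr (Or.inr ⟨i - 3 * k, by omega⟩))

/-- Entries of the matrix after all row and column operations. -/
noncomputable def finalFun (k : ℕ) (L l d r R : ℕ → ℂ) : ℕ → ℕ → ℂ :=
  colOp (2 * k) k (fun j => R j / d j) (colOp k k (fun j => r j / d j)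
    (rowOp (2 * k) k (fun j => L j / d j) (rowOp k k (fun j => l j / d j)
      (pentaFun k L l d r R))))

/-- Entries of the expected result. -/
noncomputable def targetFun (k : ℕ) (L l d r R : ℕ → ℂ) (i j : ℕ) : ℂ :=
  if i < k then (if i = j then d i else 0)
  else if j < k then 0
  else pentaFun k
          (fun a => L (a + k))
          (fun a => if a < k then l (a + k) - L a * r a / d a else l (a + k))
          (fun a => if a < k then d (a + k) - l a * r a / d a
                    else if a < 2 * k then d (a + k) - L (a - k) * R (a - k) / d (a - k)
                    else d (a + k))
          (fun a => if a < k then r (a + k) - R a * l a / d a else r (a + k))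
          (fun a => R (a + k)) (i - k) (j - k)

lemma rowOp_pos (s k : ℕ) (a : ℕ → ℂ) (F : ℕ → ℕ → ℂ) (i j : ℕ) (h : s ≤ i ∧ i < s + k) :
    rowOp s k a F i j = F i j - a (i - s) * F (i - s) j := if_pos h

lemma rowOp_neg (s k : ℕ) (a : ℕ → ℂ) (F : ℕ → ℕ → ℂ) (i j : ℕ) (h : ¬ (s ≤ i ∧ i < s + k)) :
    rowOp s k a F i j = F i j := if_neg h

lemma colOp_pos (s k : ℕ) (a : ℕ → ℂ) (F : ℕ → ℕ → ℂ) (i j : ℕ) (h : s ≤ j ∧ j < s + k) :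
    colOp s k a F i j = F i j - a (j - s) * F i (j - s) := if_pos h

lemma colOp_neg (s k : ℕ) (a : ℕ → ℂ) (F : ℕ → ℕ → ℂ) (i j : ℕ) (h : ¬ (s ≤ j ∧ j < s + k)) :
    colOp s k a F i j = F i j := if_neg h

section penta
variable (k : ℕ) (L l d r R : ℕ → ℂ) (i j : ℕ)

lemma penta_L (h : j + 2 * k = i) : pentaFun k L l d r R i j = L j := if_pos h

lemma penta_l (h : 1 ≤ k ∧ j + k = i) : pentaFun k L l d r R i j = l j := by
  unfold pentaFun
  rw [if_neg (by omega), if_pos h.2]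

lemma penta_d (h : 1 ≤ k ∧ i = j) : pentaFun k L l d r R i j = d i := by
  unfold pentaFun
  rw [if_neg (by omega), if_neg (by omega), if_pos h.2]

lemma penta_r (h : 1 ≤ k ∧ i + k = j) : pentaFun k L l d r R i j = r i := by
  unfold pentaFun
  rw [if_neg (by omega), if_neg (by omega), if_neg (by omega), if_pos h.2]

lemma penta_R (h : 1 ≤ k ∧ i + 2 * k = j) : pentaFun k L l d r R i j = R i := by
  unfold pentaFun
  rw [if_neg (by omega), if_neg (by omega), if_neg (by omega), if_neg (by omega), if_pos h.2]

lemma penta_z (h : ¬ (j + 2 * k = i) ∧ ¬ (j + k = i) ∧ ¬ (i = j) ∧ ¬ (i + k = j) ∧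
    ¬ (i + 2 * k = j)) : pentaFun k L l d r R i j = 0 := by
  unfold pentaFun
  rw [if_neg h.1, if_neg h.2.1, if_neg h.2.2.1, if_neg h.2.2.2.1, if_neg h.2.2.2.2]

end penta

lemma diff_cases (k i j : ℕ) : i = j + 2 * k ∨ i = j + k ∨ j = i ∨ j = i + k ∨ j = i + 2 * k ∨
    (¬ (j + 2 * k = i) ∧ ¬ (j + k = i) ∧ ¬ (i = j) ∧ ¬ (i + k = j) ∧ ¬ (i + 2 * k = j)) := by
  omega

set_option linter.unusedSimpArgs false in
set_option maxHeartbeats 2000000 in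
lemma final_eq_target (k : ℕ) (hk : 1 ≤ k) (L l d r R : ℕ → ℂ) (hd : ∀ j < k, d j ≠ 0)
    (i j : ℕ) : finalFun k L l d r R i j = targetFun k L l d r R i j := by
  have e1 : ∀ c, c + k - k = c := fun c => by omega
  have e2 : ∀ c, c + 2 * k - 2 * k = c := fun c => by omega
  have e3 : ∀ c, c + 2 * k - k = c + k := fun c => by omega
  have e4 : ∀ c, c + 3 * k - k = c + 2 * k := fun c => by omega
  have e5 : ∀ c, c + 4 * k - k = c + 3 * k := fun c => by omega
  have e6 : ∀ c, c + 5 * k - k = c + 4 * k := fun c => by omega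
  have f1 : ∀ c, c + k + k = c + 2 * k := fun c => by omega
  have f2 : ∀ c, c + 2 * k + k = c + 3 * k := fun c => by omega
  have f3 : ∀ c, c + 3 * k + k = c + 4 * k := fun c => by omega
  have f4 : ∀ c, c + k + 2 * k = c + 3 * k := fun c => by omega
  have f5 : ∀ c, c + 2 * k + 2 * k = c + 4 * k := fun c => by omega
  have f6 : ∀ c, c + 3 * k + 2 * k = c + 5 * k := fun c => by omega
  unfold finalFun targetFun
  rcases diff_cases k i j with rfl | rfl | rfl | rfl | rfl | h
  case inr.inr.inr.inr.inr =>
    have hz : (if i < k then (if i = j then d i else 0) else if j < k then 0 else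
      pentaFun k
          (fun a => L (a + k))
          (fun a => if a < k then l (a + k) - L a * r a / d a else l (a + k))
          (fun a => if a < k then d (a + k) - l a * r a / d a
                    else if a < 2 * k then d (a + k) - L (a - k) * R (a - k) / d (a - k)
                    else d (a + k))
          (fun a => if a < k then r (a + k) - R a * l a / d a else r (a + k))
          (fun a => R (a + k)) (i - k) (j - k)) = 0 := by
      split_ifs
      · omega
      · rfl
      · rfl
      · exact penta_z _ _ _ _ _ _ _ _ (by omega)
    rw [hz]
    rcases region k i with hi | ⟨c, hi, rfl⟩ | ⟨c, hi, rfl⟩ | ⟨c, rfl⟩ <;>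
    rcases region k j with hj | ⟨e, hj, rfl⟩ | ⟨e, hj, rfl⟩ | ⟨e, rfl⟩ <;>
    simp (disch := omega) only [rowOp_pos, rowOp_neg, colOp_pos, colOp_neg, e1, e2,
      penta_z, mul_zero, sub_zero, if_true]
  case inr.inr.inr.inl =>
    rcases region k i with hi | ⟨c, hi, rfl⟩ | ⟨c, hi, rfl⟩ | ⟨c, rfl⟩ <;>
    simp (disch := omega) only [rowOp_pos, rowOp_neg, colOp_pos, colOp_neg, e1, e2, e3, e4, e5, e6,
      f1, f2, f3, f4, f5, f6, if_pos, if_neg,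
      penta_L, penta_l, penta_d, penta_r, penta_R, penta_z, mul_zero, sub_zero, if_true]
    all_goals (try have := hd _ hi) <;> (try field_simp) <;> (try ring)
  case inr.inr.inr.inr.inl =>
    rcases region k i with hi | ⟨c, hi, rfl⟩ | ⟨c, hi, rfl⟩ | ⟨c, rfl⟩ <;>
    simp (disch := omega) only [rowOp_pos, rowOp_neg, colOp_pos, colOp_neg, e1, e2, e3, e4, e5, e6,
      f1, f2, f3, f4, f5, f6, if_pos, if_neg,
      penta_L, penta_l, penta_d, penta_r, penta_R, penta_z, mul_zero, sub_zero, if_true]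
    all_goals (try have := hd _ hi) <;> (try field_simp) <;> (try ring)
  all_goals
    rcases region k j with hi | ⟨c, hi, rfl⟩ | ⟨c, hi, rfl⟩ | ⟨c, rfl⟩ <;>
    simp (disch := omega) only [rowOp_pos, rowOp_neg, colOp_pos, colOp_neg, e1, e2, e3, e4, e5, e6,
      f1, f2, f3, f4, f5, f6, if_pos, if_neg,
      penta_L, penta_l, penta_d, penta_r, penta_R, penta_z, mul_zero, sub_zero, if_true]
  all_goals (try have := hd _ hi) <;> (try field_simp) <;> (try ring)

/-- Theorem 2 (the first elimination process): `B₁^{(L)} B₁^{(l)} A₀ B₁^{(r)} B₁^{(R)}`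
is the direct sum of the diagonal matrix with entries `d_0, …, d_{k-1}` and the
`(n+1-k) × (n+1-k)` pentadiagonal matrix with the first iterated diagonals (the entry
functions of the smaller block at index `a` correspond to original index `j = a + k`). -/
theorem first_process (n k : ℕ) (hk : 1 ≤ k) (h3k : 3 * k ≤ n)
    (L l d r R : ℕ → ℂ) (hd : ∀ j < k, d j ≠ 0) :
    (Matrix.of fun i j : Fin (n + 1) =>
        if (i : ℕ) = j then (1 : ℂ)
        else if 2 * k ≤ (i : ℕ) ∧ (i : ℕ) < 3 * k ∧ (j : ℕ) + 2 * k = i then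
          -(L j / d j)
        else 0) *
    (Matrix.of fun i j : Fin (n + 1) =>
        if (i : ℕ) = j then (1 : ℂ)
        else if k ≤ (i : ℕ) ∧ (i : ℕ) < 2 * k ∧ (j : ℕ) + k = i then
          -(l j / d j)
        else 0) *
    pentaMat (n + 1) k L l d r R *
    (Matrix.of fun i j : Fin (n + 1) =>
        if (i : ℕ) = j then (1 : ℂ)
        else if (i : ℕ) < k ∧ (i : ℕ) + k = j then -(r i / d i) else 0) *
    (Matrix.of fun i j : Fin (n + 1) =>
        if (i : ℕ) = j then (1 : ℂ)
        else if (i : ℕ) < k ∧ (i : ℕ) + 2 * k = j then -(R i / d i) else 0) =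
    Matrix.reindex (finSumFinEquiv.trans (finCongr (by omega)))
      (finSumFinEquiv.trans (finCongr (by omega)))
      (Matrix.fromBlocks
        (Matrix.diagonal fun i : Fin k => d i) 0 0
        (pentaMat (n + 1 - k) k
          (fun a => L (a + k))
          (fun a => if a < k then l (a + k) - L a * r a / d a else l (a + k))
          (fun a => if a < k then d (a + k) - l a * r a / d a
                    else if a < 2 * k then d (a + k) - L (a - k) * R (a - k) / d (a - k)
                    else d (a + k))
          (fun a => if a < k then r (a + k) - R a * l a / d a else r (a + k))
          (fun a => R (a + k)))) := by
  rw [Matrix.mul_assoc (Matrix.of _) (Matrix.of _) (pentaMat _ _ _ _ _ _ _)]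
  unfold pentaMat
  rw [left_op (n + 1) k k hk (fun j => l j / d j) (pentaFun k L l d r R) (Matrix.of _) (by
      intro i j
      simp only [Matrix.of_apply, and_assoc, two_mul])]
  rw [left_op (n + 1) (2 * k) k (by omega) (fun j => L j / d j) _ (Matrix.of _) (by
      intro i j
      have h : 2 * k + k = 3 * k := by omega
      simp only [Matrix.of_apply, and_assoc, h])]
  rw [right_op (n + 1) k k hk (fun j => r j / d j) _ (Matrix.of _) (by
      intro i j
      simp only [Matrix.of_apply])]
  rw [right_op (n + 1) (2 * k) k (by omega) (fun j => R j / d j) _ (Matrix.of _) (by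
      intro i j
      simp only [Matrix.of_apply])]
  rw [← Equiv.symm_apply_eq]
  ext x y
  have key := final_eq_target k hk L l d r R hd
  unfold finalFun targetFun at key
  rcases x with ⟨x, hx⟩ | ⟨x, hx⟩ <;> rcases y with ⟨y, hy⟩ | ⟨y, hy⟩ <;>
    simp [Matrix.fromBlocks, Matrix.diagonal_apply, key, hx, hy]
  intro h
  omega
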